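/- arXiv:2202.08402 — 2 statements merged into one kernel-verified Lean document; each statement's English description precedes it below -/
import Mathlib

section
/- For every t ∈ ℤ, the expected aggregated update satisfies the momentum recursion D(t) = β · D(t−1) − (1−β) · η · g(t); that is, the expected change of the global parameter vector at round t+1 equals β times the expected change at round t minus (1−β)η times the fresh aggregated gradient. (Lemma 1 of the paper.) -/
theorem summable_geometric_smul_of_norm_le {E : Type*} [NormedAddCommGroup E] [NormedSpace ℝ E]
    [CompleteSpace E] {β M : ℝ} (hβ0 : 0 ≤ β) (hβ1 : β < 1) {u : ℕ → E} (hu : ∀ l, ‖u l‖ ≤ M)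
    (c : ℝ) : Summable fun l : ℕ => (c * β ^ l) • u l := by
  refine Summable.of_norm_bounded
    (((summable_geometric_of_lt_one hβ0 hβ1).mul_left |c|).mul_right M) fun l => ?_
  rw [norm_smul, norm_mul, Real.norm_eq_abs, norm_pow, Real.norm_of_nonneg hβ0]
  exact mul_le_mul_of_nonneg_left (hu l) (by positivity)

/-- A geometrically discounted sum over the past of a bounded sequence satisfies a one-step
recursion. -/
theorem tsum_geometric_smul_sub_eq {E : Type*} [NormedAddCommGroup E] [NormedSpace ℝ E]
    [CompleteSpace E] {β M : ℝ} (hβ0 : 0 ≤ β) (hβ1 : β < 1) {f : ℤ → E} (hf : ∀ t, ‖f t‖ ≤ M)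
    (c : ℝ) (t : ℤ) :
    ∑' l : ℕ, (c * β ^ l) • f (t - l) =
      c • f t + β • ∑' l : ℕ, (c * β ^ l) • f (t - 1 - l) := by
  have hs (t : ℤ) : Summable fun l : ℕ => (c * β ^ l) • f (t - l) :=
    summable_geometric_smul_of_norm_le hβ0 hβ1 (fun l => hf _) c
  rw [(hs t).tsum_eq_zero_add, ← (hs (t - 1)).tsum_const_smul β]
  congr 1
  · simp
  · refine tsum_congr fun l => ?_
    rw [smul_smul, show t - ((l + 1 : ℕ) : ℤ) = t - 1 - l by push_cast; ring]
    congr 1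
    ring

/-- Lemma 1 of the paper: the expected aggregated update satisfies the
momentum recursion `D t = β • D (t-1) - (1-β)η • g t`. -/
theorem stmt_0
    (d K : ℕ) (hd : 0 < d) (hK : 0 < K)
    (β η M : ℝ) (hβ0 : 0 ≤ β) (hβ1 : β < 1) (hη : 0 < η)
    (p : Fin K → ℝ) (hp0 : ∀ k, 0 ≤ p k) (hp1 : ∑ k, p k = 1)
    (g : Fin K → ℤ → EuclideanSpace ℝ (Fin d))
    (hg : ∀ k t, ‖g k t‖ ≤ M)
    (G : Fin K → ℤ → EuclideanSpace ℝ (Fin d))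
    (hG : ∀ k t, G k t = ∑' l : ℕ, ((1 - β) * β ^ l) • g k (t - (l : ℤ)))
    (gbar : ℤ → EuclideanSpace ℝ (Fin d))
    (hgbar : ∀ t, gbar t = ∑ k, p k • g k t)
    (D : ℤ → EuclideanSpace ℝ (Fin d))
    (hD : ∀ t, D t = -(η • ∑ k, p k • G k t)) :
    ∀ t : ℤ, D t = β • D (t - 1) - ((1 - β) * η) • gbar t := by
  intro t
  have hrec (k : Fin K) : G k t = (1 - β) • g k t + β • G k (t - 1) := by
    rw [hG, hG]
    exact tsum_geometric_smul_sub_eq hβ0 hβ1 (hg k) (1 - β) t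
  have hsum : ∑ k, p k • G k t =
      (1 - β) • ∑ k, p k • g k t + β • ∑ k, p k • G k (t - 1) := by
    simp only [hrec, smul_add, Finset.sum_add_distrib, Finset.smul_sum, smul_comm (p _)]
  rw [hD, hD, hgbar, hsum]
  module
end

section
/- Let T be a positive integer and F, G : ℕ → ℝ sequences with G(t) ≥ 0 for all t. Let c ∈ (0,1], L > 0, σ ≥ 0, F* be real numbers with F(0) − F* + σ² ≥ 0, set η = 1/√(L·T), and assume T ≥ 4L/c², F(t) ≥ F* for all t ≤ T, and the per-round descent inequality F(t+1) ≤ F(t) − c·η·G(t) + L·η²·( G(t) + σ² ) holds for every t < T. Then min_{0 ≤ t ≤ T−1} G(t) ≤ 2·√L·( F(0) − F* + σ² ) / ( c·√T ). (Theorem 1 of the paper in deterministic sequence form, with c = 1 − (1−μ)β.) -/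
/-- Theorem 1 of the paper in deterministic sequence form, with
`c = 1 − (1−μ)β` and step size `η = 1/√(L·T)`. -/
theorem stmt_8
    (T : ℕ) (hT : 0 < T)
    (F G : ℕ → ℝ) (hG : ∀ t, 0 ≤ G t)
    (c L σ Fstar η : ℝ)
    (hc0 : 0 < c) (hc1 : c ≤ 1) (hL : 0 < L) (hσ : 0 ≤ σ)
    (hnum : 0 ≤ F 0 - Fstar + σ ^ 2)
    (hη : η = 1 / Real.sqrt (L * T))
    (hTlarge : (T : ℝ) ≥ 4 * L / c ^ 2)
    (hFstar : ∀ t ≤ T, Fstar ≤ F t)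
    (hdescent : ∀ t < T, F (t + 1) ≤ F t - c * η * G t + L * η ^ 2 * (G t + σ ^ 2)) :
    (Finset.range T).inf' (Finset.nonempty_range_iff.mpr hT.ne') G
      ≤ 2 * Real.sqrt L * (F 0 - Fstar + σ ^ 2) / (c * Real.sqrt T) := by
  have hT' : (0 : ℝ) < T := Nat.cast_pos.mpr hT
  rw [Real.sqrt_mul hL.le] at hη
  have ha : 0 < √L := Real.sqrt_pos.mpr hL
  have hb : 0 < √(T : ℝ) := Real.sqrt_pos.mpr hT'
  have haL : √L ^ 2 = L := Real.sq_sqrt hL.le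
  have hbT : √(T : ℝ) ^ 2 = T := Real.sq_sqrt hT'.le
  generalize √L = a at *
  generalize √(T : ℝ) = b at *
  have hLη : L * η ^ 2 = 1 / T := by
    rw [hη, ← haL, ← hbT]
    field_simp
  have hab : 2 * a ≤ c * b := by
    rw [ge_iff_le, div_le_iff₀ (by positivity), ← haL, ← hbT] at hTlarge
    exact (sq_le_sq₀ (by positivity) (by positivity)).mp (by linarith)
  have hstep : 1 / (T : ℝ) ≤ c * η / 2 := by
    rw [hη, ← hbT, mul_one_div, div_div, div_le_div_iff₀ (by positivity) (by positivity)]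
    nlinarith [mul_le_mul_of_nonneg_right hab hb.le]
  have hmin : ∀ t < T,
      (Finset.range T).inf' (Finset.nonempty_range_iff.mpr hT.ne') G ≤ G t :=
    fun t ht => Finset.inf'_le _ (Finset.mem_range.mpr ht)
  generalize (Finset.range T).inf' (Finset.nonempty_range_iff.mpr hT.ne') G = m at *
  have hη0 : 0 < η := by rw [hη]; positivity
  have htelescope : ∀ n ≤ T, F n ≤ F 0 - n * (c * η / 2 * m - 1 / T * σ ^ 2) := by
    intro n
    induction n with
    | zero => simp
    | succ n ih =>
      intro hn
      have hF := hdescent n hn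
      rw [hLη] at hF
      have hGn := mul_le_mul_of_nonneg_right hstep (hG n)
      have hm := mul_le_mul_of_nonneg_left (hmin n hn) (by positivity : 0 ≤ c * η / 2)
      push_cast
      linarith [ih (by omega)]
  have hfinal := (hFstar T le_rfl).trans (htelescope T le_rfl)
  have hTη : T * (c * η / 2 * m - 1 / T * σ ^ 2) = m * (c * b) / (2 * a) - σ ^ 2 := by
    rw [hη, ← hbT]
    field_simp
  have hbound : m * (c * b) / (2 * a) ≤ F 0 - Fstar + σ ^ 2 := by linarith
  rw [div_le_iff₀ (by positivity)] at hbound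
  rw [le_div_iff₀ (by positivity)]
  linarith
end
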